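/- Let a20, a11, a02, a10, a01, a00 and a20', a11', a02', a10', a01', a00' and g be smooth real functions on ℝ², and define L u = ∂_x∂_x∂_y u + ∂_x∂_y∂_y u + a20·∂_x∂_x u + a11·∂_x∂_y u + a02·∂_y∂_y u + a10·∂_x u + a01·∂_y u + a00·u, and L' analogously with the primed coefficients. If L' u = e^{−g}·L(e^{g}·u) for every smooth u : ℝ² → ℝ, then the extra invariant agrees: a11' − 2·a20' − 2·a02' = a11 − 2·a20 − 2·a02. -/

import Mathlib

noncomputable def dx (f : (Fin 2 → ℝ) → ℝ) : (Fin 2 → ℝ) → ℝ :=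
  fun p => fderiv ℝ f p (Pi.single 0 1)

noncomputable def dy (f : (Fin 2 → ℝ) → ℝ) : (Fin 2 → ℝ) → ℝ :=
  fun p => fderiv ℝ f p (Pi.single 1 1)

lemma contDiff_add_pi {f h : (Fin 2 → ℝ) → ℝ} (hf : ContDiff ℝ (⊤ : ℕ∞) f)
    (hh : ContDiff ℝ (⊤ : ℕ∞) h) : ContDiff ℝ (⊤ : ℕ∞) (f + h) :=
  hf.add hh

lemma contDiff_mul_pi {f h : (Fin 2 → ℝ) → ℝ} (hf : ContDiff ℝ (⊤ : ℕ∞) f)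
    (hh : ContDiff ℝ (⊤ : ℕ∞) h) : ContDiff ℝ (⊤ : ℕ∞) (f * h) :=
  hf.mul hh

lemma contDiff_dx {f : (Fin 2 → ℝ) → ℝ} (hf : ContDiff ℝ (⊤ : ℕ∞) f) :
    ContDiff ℝ (⊤ : ℕ∞) (dx f) :=
  (hf.fderiv_right (by simp)).clm_apply contDiff_const

lemma contDiff_dy {f : (Fin 2 → ℝ) → ℝ} (hf : ContDiff ℝ (⊤ : ℕ∞) f) :
    ContDiff ℝ (⊤ : ℕ∞) (dy f) :=
  (hf.fderiv_right (by simp)).clm_apply contDiff_const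

lemma dx_add {f h : (Fin 2 → ℝ) → ℝ} (hf : ContDiff ℝ (⊤ : ℕ∞) f)
    (hh : ContDiff ℝ (⊤ : ℕ∞) h) : dx (f + h) = dx f + dx h := by
  funext p
  simp [dx, fderiv_add (hf.differentiable (by simp) p) (hh.differentiable (by simp) p)]

lemma dy_add {f h : (Fin 2 → ℝ) → ℝ} (hf : ContDiff ℝ (⊤ : ℕ∞) f)
    (hh : ContDiff ℝ (⊤ : ℕ∞) h) : dy (f + h) = dy f + dy h := by
  funext p
  simp [dy, fderiv_add (hf.differentiable (by simp) p) (hh.differentiable (by simp) p)]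

lemma dx_mul {f h : (Fin 2 → ℝ) → ℝ} (hf : ContDiff ℝ (⊤ : ℕ∞) f)
    (hh : ContDiff ℝ (⊤ : ℕ∞) h) : dx (f * h) = dx f * h + f * dx h := by
  funext p
  simp [dx, fderiv_mul (hf.differentiable (by simp) p) (hh.differentiable (by simp) p)]
  ring

lemma dy_mul {f h : (Fin 2 → ℝ) → ℝ} (hf : ContDiff ℝ (⊤ : ℕ∞) f)
    (hh : ContDiff ℝ (⊤ : ℕ∞) h) : dy (f * h) = dy f * h + f * dy h := by
  funext p
  simp [dy, fderiv_mul (hf.differentiable (by simp) p) (hh.differentiable (by simp) p)]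
  ring

lemma dx_exp {g : (Fin 2 → ℝ) → ℝ} (hg : ContDiff ℝ (⊤ : ℕ∞) g) (p : Fin 2 → ℝ) :
    dx (fun y => Real.exp (g y)) p = Real.exp (g p) * dx g p := by
  simp [dx, fderiv_exp (hg.differentiable (by simp) p)]

lemma dy_exp {g : (Fin 2 → ℝ) → ℝ} (hg : ContDiff ℝ (⊤ : ℕ∞) g) (p : Fin 2 → ℝ) :
    dy (fun y => Real.exp (g y)) p = Real.exp (g p) * dy g p := by
  simp [dy, fderiv_exp (hg.differentiable (by simp) p)]

lemma hasFDerivAt_affine (a b c : ℝ) (q : Fin 2 → ℝ) :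
    HasFDerivAt (fun q : Fin 2 → ℝ => a * q 0 + b * q 1 + c)
      (a • ContinuousLinearMap.proj (R := ℝ) (φ := fun _ : Fin 2 => ℝ) 0
        + b • ContinuousLinearMap.proj (R := ℝ) (φ := fun _ : Fin 2 => ℝ) 1) q :=
  (((hasFDerivAt_apply 0 q).const_mul a).add ((hasFDerivAt_apply 1 q).const_mul b)).add_const c

lemma dx_affine (a b c : ℝ) :
    dx (fun q : Fin 2 → ℝ => a * q 0 + b * q 1 + c) = fun _ => a := by
  funext q
  simp [dx, (hasFDerivAt_affine a b c q).fderiv]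

lemma dy_affine (a b c : ℝ) :
    dy (fun q : Fin 2 → ℝ => a * q 0 + b * q 1 + c) = fun _ => b := by
  funext q
  simp [dy, (hasFDerivAt_affine a b c q).fderiv]

lemma dx_const (c : ℝ) : dx (fun _ => c) = fun _ => 0 := by
  funext q
  simp [dx]

/-- The partial derivatives of `e * u` up to third order at a point where `u` vanishes to
first order. -/
lemma partials_mul_of_vanishing {e u : (Fin 2 → ℝ) → ℝ} (he : ContDiff ℝ (⊤ : ℕ∞) e)
    (hu : ContDiff ℝ (⊤ : ℕ∞) u) {p : Fin 2 → ℝ} (h0 : u p = 0) (hx : dx u p = 0)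
    (hy : dy u p = 0) :
    dx (e * u) p = 0 ∧ dy (e * u) p = 0 ∧
    dx (dx (e * u)) p = e p * dx (dx u) p ∧
    dx (dy (e * u)) p = e p * dx (dy u) p ∧
    dy (dy (e * u)) p = e p * dy (dy u) p ∧
    dx (dx (dy (e * u))) p =
      dy e p * dx (dx u) p + 2 * dx e p * dx (dy u) p + e p * dx (dx (dy u)) p ∧
    dx (dy (dy (e * u))) p =
      dx e p * dy (dy u) p + 2 * dy e p * dx (dy u) p + e p * dx (dy (dy u)) p := by
  have hex := contDiff_dx he
  have hey := contDiff_dy he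
  have hux := contDiff_dx hu
  have huy := contDiff_dy hu
  have hexy := contDiff_dx hey
  have huxy := contDiff_dx huy
  have heyy := contDiff_dy hey
  have huyy := contDiff_dy huy
  have ex : dx (e * u) = dx e * u + e * dx u := dx_mul he hu
  have ey : dy (e * u) = dy e * u + e * dy u := dy_mul he hu
  have exx : dx (dx (e * u)) = dx (dx e) * u + dx e * dx u + (dx e * dx u + e * dx (dx u)) := by
    rw [ex, dx_add (contDiff_mul_pi hex hu) (contDiff_mul_pi he hux), dx_mul hex hu, dx_mul he hux]
  have exy : dx (dy (e * u)) = dx (dy e) * u + dy e * dx u + (dx e * dy u + e * dx (dy u)) := by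
    rw [ey, dx_add (contDiff_mul_pi hey hu) (contDiff_mul_pi he huy), dx_mul hey hu, dx_mul he huy]
  have eyy : dy (dy (e * u)) = dy (dy e) * u + dy e * dy u + (dy e * dy u + e * dy (dy u)) := by
    rw [ey, dy_add (contDiff_mul_pi hey hu) (contDiff_mul_pi he huy), dy_mul hey hu, dy_mul he huy]
  have exxy := congrArg dx exy
  rw [dx_add (contDiff_add_pi (contDiff_mul_pi hexy hu) (contDiff_mul_pi hey hux))
      (contDiff_add_pi (contDiff_mul_pi hex huy) (contDiff_mul_pi he huxy)),
    dx_add (contDiff_mul_pi hexy hu) (contDiff_mul_pi hey hux), dx_add (contDiff_mul_pi hex huy) (contDiff_mul_pi he huxy),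
    dx_mul hexy hu, dx_mul hey hux, dx_mul hex huy, dx_mul he huxy] at exxy
  have exyy := congrArg dx eyy
  rw [dx_add (contDiff_add_pi (contDiff_mul_pi heyy hu) (contDiff_mul_pi hey huy))
      (contDiff_add_pi (contDiff_mul_pi hey huy) (contDiff_mul_pi he huyy)),
    dx_add (contDiff_mul_pi heyy hu) (contDiff_mul_pi hey huy), dx_add (contDiff_mul_pi hey huy) (contDiff_mul_pi he huyy),
    dx_mul heyy hu, dx_mul hey huy, dx_mul he huyy] at exyy
  rw [exxy, exyy, exx, exy, eyy, ex, ey]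
  simp only [Pi.add_apply, Pi.mul_apply, h0, hx, hy]
  refine ⟨?_, ?_, ?_, ?_, ?_, ?_, ?_⟩ <;> ring

theorem extra_invariant_xxy_xyy
    (a20 a11 a02 a10 a01 a00 a20' a11' a02' a10' a01' a00' g : (Fin 2 → ℝ) → ℝ)
    (h20 : ContDiff ℝ (⊤ : ℕ∞) a20) (h11 : ContDiff ℝ (⊤ : ℕ∞) a11) (h02 : ContDiff ℝ (⊤ : ℕ∞) a02)
    (h10 : ContDiff ℝ (⊤ : ℕ∞) a10) (h01 : ContDiff ℝ (⊤ : ℕ∞) a01) (h00 : ContDiff ℝ (⊤ : ℕ∞) a00)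
    (h20' : ContDiff ℝ (⊤ : ℕ∞) a20') (h11' : ContDiff ℝ (⊤ : ℕ∞) a11') (h02' : ContDiff ℝ (⊤ : ℕ∞) a02')
    (h10' : ContDiff ℝ (⊤ : ℕ∞) a10') (h01' : ContDiff ℝ (⊤ : ℕ∞) a01') (h00' : ContDiff ℝ (⊤ : ℕ∞) a00')
    (hg : ContDiff ℝ (⊤ : ℕ∞) g)
    (hgauge : ∀ u : (Fin 2 → ℝ) → ℝ, ContDiff ℝ (⊤ : ℕ∞) u → ∀ x,
      dx (dx (dy u)) x + dx (dy (dy u)) x + a20' x * dx (dx u) x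
        + a11' x * dx (dy u) x + a02' x * dy (dy u) x
        + a10' x * dx u x + a01' x * dy u x + a00' x * u x =
      Real.exp (-(g x)) *
        (dx (dx (dy (fun y => Real.exp (g y) * u y))) x
          + dx (dy (dy (fun y => Real.exp (g y) * u y))) x
          + a20 x * dx (dx (fun y => Real.exp (g y) * u y)) x
          + a11 x * dx (dy (fun y => Real.exp (g y) * u y)) x
          + a02 x * dy (dy (fun y => Real.exp (g y) * u y)) x
          + a10 x * dx (fun y => Real.exp (g y) * u y) x
          + a01 x * dy (fun y => Real.exp (g y) * u y) x
          + a00 x * (Real.exp (g x) * u x))) :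
    ∀ x, a11' x - 2 * a20' x - 2 * a02' x = a11 x - 2 * a20 x - 2 * a02 x := by
  intro p
  let X : (Fin 2 → ℝ) → ℝ := fun q => 1 * q 0 + 0 * q 1 + -p 0
  let V : (Fin 2 → ℝ) → ℝ := fun q => (-1) * q 0 + 1 * q 1 + (p 0 - p 1)
  let Y : (Fin 2 → ℝ) → ℝ := fun q => 0 * q 0 + 1 * q 1 + -p 1
  let W : (Fin 2 → ℝ) → ℝ := fun q => 0 * q 0 + (-1) * q 1 + p 1
  have hX : ContDiff ℝ (⊤ : ℕ∞) X := by fun_prop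
  have hY : ContDiff ℝ (⊤ : ℕ∞) Y := by fun_prop
  have hV : ContDiff ℝ (⊤ : ℕ∞) V := by fun_prop
  have hW : ContDiff ℝ (⊤ : ℕ∞) W := by fun_prop
  have hu : ContDiff ℝ (⊤ : ℕ∞) (X * V + Y * W) := contDiff_add_pi (contDiff_mul_pi hX hV) (contDiff_mul_pi hY hW)
  have hux : dx (X * V + Y * W) = fun q => (-2) * q 0 + 1 * q 1 + (2 * p 0 - p 1) := by
    rw [dx_add (contDiff_mul_pi hX hV) (contDiff_mul_pi hY hW), dx_mul hX hV, dx_mul hY hW]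
    simp only [X, Y, V, W, dx_affine]
    funext q
    simp only [Pi.add_apply, Pi.mul_apply]
    ring
  have huy : dy (X * V + Y * W) = fun q => 1 * q 0 + (-2) * q 1 + (2 * p 1 - p 0) := by
    rw [dy_add (contDiff_mul_pi hX hV) (contDiff_mul_pi hY hW), dy_mul hX hV, dy_mul hY hW]
    simp only [X, Y, V, W, dy_affine]
    funext q
    simp only [Pi.add_apply, Pi.mul_apply]
    ring
  have h0 : (X * V + Y * W) p = 0 := by
    simp only [X, Y, V, W, Pi.add_apply, Pi.mul_apply]
    ring
  have hx0 : dx (X * V + Y * W) p = 0 := by rw [hux]; ring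
  have hy0 : dy (X * V + Y * W) p = 0 := by rw [huy]; ring
  obtain ⟨ex, ey, exx, exy, eyy, exxy, exyy⟩ :=
    partials_mul_of_vanishing (e := fun y => Real.exp (g y)) hg.exp hu h0 hx0 hy0
  have key := hgauge _ hu p
  change _ = Real.exp (-(g p)) *
    (dx (dx (dy ((fun y => Real.exp (g y)) * (X * V + Y * W)))) p
      + dx (dy (dy ((fun y => Real.exp (g y)) * (X * V + Y * W)))) p
      + a20 p * dx (dx ((fun y => Real.exp (g y)) * (X * V + Y * W))) p
      + a11 p * dx (dy ((fun y => Real.exp (g y)) * (X * V + Y * W))) p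
      + a02 p * dy (dy ((fun y => Real.exp (g y)) * (X * V + Y * W))) p
      + a10 p * dx ((fun y => Real.exp (g y)) * (X * V + Y * W)) p
      + a01 p * dy ((fun y => Real.exp (g y)) * (X * V + Y * W)) p
      + a00 p * (Real.exp (g p) * (X * V + Y * W) p)) at key
  rw [ex, ey, exx, exy, eyy, exxy, exyy, h0, hx0, hy0, hux, huy, dx_exp hg, dy_exp hg] at key
  simp only [dx_affine, dy_affine, dx_const] at key
  have hexp : Real.exp (-(g p)) * Real.exp (g p) = 1 := by
    rw [← Real.exp_add, neg_add_cancel, Real.exp_zero]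
  linear_combination key + (a11 p - 2 * a20 p - 2 * a02 p) * hexp
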